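/- Fundamental lemma for Kripke logical relations over open STLC terms: let (Y, ⟦–⟧) be an algebra for the presentation of the STLC with βη-equality, f : X → Y a clone homomorphism, and Q(Γ;b) ⊆ Y(Γ;b) a family of subsets at base type. Extend Q to all types by Q(Γ; A⇒B) = { t ∈ Y(Γ;A⇒B) | for every context Δ, every variable renaming ρ ∈ Var(Δ;Γ), and every a ∈ Q(Δ;A), ⟦app⟧_Δ(t[▷ρ], a) ∈ Q(Δ;B) }. If (i) var^Γ_i ∈ Q(Γ;Γ_i) for every Γ, i; (ii) Q(–;b) is closed under variable renamings (t ∈ Q(Γ;b) and ρ ∈ Var(Δ;Γ) imply t[▷ρ] ∈ Q(Δ;b)); and (iii) for every t ∈ X(Γ;B) and every σ with σ_j ∈ Q(Δ;Γ_j), (f_{Γ;B}(t))[σ] ∈ Q(Δ;B); then f̂_{Γ;A}(t) ∈ Q(Γ;A) for every free term t ∈ (F X)(Γ;A). -/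

import Mathlib

/-- Data of an `S`-sorted abstract clone: term sets, variables, substitution. -/
structure CloneData (S : Type) : Type 1 where
  T : List S → S → Type
  varC : (Γ : List S) → (i : Fin Γ.length) → T Γ (Γ.get i)
  substC : {Γ Δ : List S} → {A : S} → T Δ A → ((i : Fin Δ.length) → T Γ (Δ.get i)) → T Γ A

namespace CloneData

variable {S : Type}

/-- Substitutions `σ ∈ X(Γ;Δ)`. -/
abbrev Sub (X : CloneData S) (Γ Δ : List S) : Type := (i : Fin Δ.length) → X.T Γ (Δ.get i)

def castT (X : CloneData S) {Γ : List S} {A B : S} (h : A = B) (t : X.T Γ A) : X.T Γ B := h ▸ t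

def castCtx (X : CloneData S) {Γ Γ' : List S} {A : S} (h : Γ = Γ') (t : X.T Γ A) : X.T Γ' A :=
  h ▸ t

end CloneData

/-- The three clone laws. -/
def IsClone {S : Type} (X : CloneData S) : Prop :=
  (∀ (Γ Δ : List S) (i : Fin Δ.length) (σ : X.Sub Γ Δ), X.substC (X.varC Δ i) σ = σ i) ∧
  (∀ (Γ : List S) (A : S) (t : X.T Γ A), X.substC t (X.varC Γ) = t) ∧
  (∀ (Γ Δ Ξ : List S) (A : S) (t : X.T Ξ A) (σ' : X.Sub Δ Ξ) (σ : X.Sub Γ Δ),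
    X.substC t (fun i => X.substC (σ' i) σ) = X.substC (X.substC t σ') σ)

/-- Clone homomorphisms: families of maps preserving variables and substitution. -/
def IsCloneHom {S : Type} (X Y : CloneData S) (f : ∀ (Γ : List S) (A : S), X.T Γ A → Y.T Γ A) :
    Prop :=
  (∀ (Γ : List S) (i : Fin Γ.length), f Γ (Γ.get i) (X.varC Γ i) = Y.varC Γ i) ∧
  (∀ (Γ Δ : List S) (A : S) (t : X.T Δ A) (σ : X.Sub Γ Δ),
    f Γ A (X.substC t σ) = Y.substC (f Δ A t) (fun i => f Γ (Δ.get i) (σ i)))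
namespace CloneAux

theorem get_append_left {α : Type} (Γ Ξ : List α) {j : ℕ} (h : j < Γ.length)
    (h2 : j < (Γ ++ Ξ).length) : (Γ ++ Ξ).get ⟨j, h2⟩ = Γ.get ⟨j, h⟩ := by
  simp [List.get_eq_getElem, List.getElem_append_left, h]

theorem get_append_right {α : Type} (Γ Ξ : List α) {j : ℕ} (h : ¬ j < Γ.length)
    (h2 : j < (Γ ++ Ξ).length) (h3 : j - Γ.length < Ξ.length) :
    (Γ ++ Ξ).get ⟨j, h2⟩ = Ξ.get ⟨j - Γ.length, h3⟩ := by
  simp only [List.get_eq_getElem]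
  rw [List.getElem_append_right (by omega)]

theorem sub_lt_of_append {α : Type} {Γ Ξ : List α} {j : ℕ} (h : ¬ j < Γ.length)
    (h2 : j < (Γ ++ Ξ).length) : j - Γ.length < Ξ.length := by
  simp only [List.length_append] at h2; omega

theorem add_lt_append {α : Type} (Γ Ξ : List α) {j : ℕ} (h : j < Ξ.length) :
    Γ.length + j < (Γ ++ Ξ).length := by
  simp only [List.length_append]; omega

theorem get_append_add {α : Type} (Γ Ξ : List α) {j : ℕ} (h : j < Ξ.length)
    (h2 : Γ.length + j < (Γ ++ Ξ).length) :
    (Γ ++ Ξ).get ⟨Γ.length + j, h2⟩ = Ξ.get ⟨j, h⟩ := by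
  simp only [List.get_eq_getElem]
  rw [List.getElem_append_right (by omega)]
  congr 1; omega

theorem le_append_length {α : Type} (Γ Ξ : List α) : Γ.length ≤ (Γ ++ Ξ).length := by
  simp [List.length_append]

end CloneAux
namespace CloneData

variable {S : Type}

/-- The weakening substitution `▷ wk^Γ_Ξ ∈ X(Γ,Ξ;Γ)`: the first `|Γ|` variables of `Γ ++ Ξ`. -/
def wkVar (X : CloneData S) (Γ Ξ : List S) : X.Sub (Γ ++ Ξ) Γ := fun i =>
  X.castT (CloneAux.get_append_left Γ Ξ i.isLt _)
    (X.varC (Γ ++ Ξ) ⟨(i : ℕ), lt_of_lt_of_le i.isLt (CloneAux.le_append_length Γ Ξ)⟩)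

/-- Extend a substitution `σ ∈ X(Γ,Ξ;Δ)` to `X(Γ,Ξ;Δ,Ξ)`, sending the extra variables of `Ξ`
to the corresponding variables of `Γ,Ξ`. -/
def extSub (X : CloneData S) (Ξ Γ Δ : List S)
    (σ : (i : Fin Δ.length) → X.T (Γ ++ Ξ) (Δ.get i)) : X.Sub (Γ ++ Ξ) (Δ ++ Ξ) := fun j =>
  if h : (j : ℕ) < Δ.length then
    X.castT (CloneAux.get_append_left Δ Ξ h j.isLt).symm (σ ⟨(j : ℕ), h⟩)
  else
    X.castT
      ((CloneAux.get_append_add Γ Ξ (CloneAux.sub_lt_of_append h j.isLt) _).trans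
        (CloneAux.get_append_right Δ Ξ h j.isLt (CloneAux.sub_lt_of_append h j.isLt)).symm)
      (X.varC (Γ ++ Ξ)
        ⟨Γ.length + ((j : ℕ) - Δ.length),
          CloneAux.add_lt_append Γ Ξ (CloneAux.sub_lt_of_append h j.isLt)⟩)

/-- The context extension `⟨Ξ⟩X`, with `(⟨Ξ⟩X)(Γ;A) = X(Γ,Ξ;A)`. -/
def ext (X : CloneData S) (Ξ : List S) : CloneData S where
  T Γ A := X.T (Γ ++ Ξ) A
  varC Γ i := X.wkVar Γ Ξ i
  substC {Γ Δ A} t σ := X.substC t (X.extSub Ξ Γ Δ σ)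

/-- The weakening map `wk^Ξ_X : X → ⟨Ξ⟩X`, sending `t` to `t[▷wk^Γ_Ξ]`. -/
def wkHom (X : CloneData S) (Ξ : List S) (Γ : List S) (A : S) (t : X.T Γ A) :
    (X.ext Ξ).T Γ A :=
  X.substC t (X.wkVar Γ Ξ)

end CloneData
namespace CloneData

/-- Lift a substitution `σ ∈ Y(Ξ;Γ)` to `σ↑Δ ∈ Y(Ξ,Δ;Γ,Δ)`: weaken the terms of `σ` and send
the extra variables of `Δ` to the corresponding variables of `Ξ,Δ`. -/
def liftSub {S : Type} (Y : CloneData S) {Ξ Γ : List S} (σ : Y.Sub Ξ Γ) (Δ : List S) :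
    Y.Sub (Ξ ++ Δ) (Γ ++ Δ) := fun j =>
  if h : (j : ℕ) < Γ.length then
    Y.castT (CloneAux.get_append_left Γ Δ h j.isLt).symm
      (Y.substC (σ ⟨(j : ℕ), h⟩) (Y.wkVar Ξ Δ))
  else
    Y.castT
      ((CloneAux.get_append_add Ξ Δ (CloneAux.sub_lt_of_append h j.isLt) _).trans
        (CloneAux.get_append_right Γ Δ h j.isLt (CloneAux.sub_lt_of_append h j.isLt)).symm)
      (Y.varC (Ξ ++ Δ)
        ⟨Ξ.length + ((j : ℕ) - Γ.length),
          CloneAux.add_lt_append Ξ Δ (CloneAux.sub_lt_of_append h j.isLt)⟩)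

end CloneData
namespace CloneData

/-- The substitution `(σ, u) ∈ Y(Ξ; Γ,A)` extending `σ ∈ Y(Ξ;Γ)` by a term `u ∈ Y(Ξ;A)`. -/
def snocSub {S : Type} (Y : CloneData S) {Ξ Γ : List S} {A : S} (σ : Y.Sub Ξ Γ) (u : Y.T Ξ A) :
    Y.Sub Ξ (Γ ++ [A]) := fun j =>
  if h : (j : ℕ) < Γ.length then
    Y.castT (CloneAux.get_append_left Γ [A] h j.isLt).symm (σ ⟨(j : ℕ), h⟩)
  else
    Y.castT
      (by
        have h3 := CloneAux.sub_lt_of_append h j.isLt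
        have := CloneAux.get_append_right Γ [A] h j.isLt h3
        rw [this]
        have : (j : ℕ) - Γ.length = 0 := by simp at h3; omega
        simp [this])
      u

/-- The last variable `var_{n+1} ∈ Y(Γ,A;A)` of the extended context `Γ,A`. -/
def lastVar {S : Type} (Y : CloneData S) (Γ : List S) (A : S) : Y.T (Γ ++ [A]) A :=
  Y.castT
    (by
      have h2 : Γ.length < (Γ ++ [A]).length := by simp
      have := CloneAux.get_append_right Γ [A] (lt_irrefl Γ.length) h2 (by simp)
      rw [this]; simp)
    (Y.varC (Γ ++ [A]) ⟨Γ.length, by simp⟩)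

end CloneData
/-- Simple types: freely generated by a base type and function types. -/
inductive Ty : Type
  | base : Ty
  | arrow : Ty → Ty → Ty
/-- The data of an algebra for the presentation of the STLC: a `Ty`-sorted clone together
with interpretations of the application and abstraction operators. -/
structure STLCAlgData : Type 1 where
  C : CloneData Ty
  app : ∀ (Γ : List Ty) (A B : Ty), C.T Γ (Ty.arrow A B) → C.T Γ A → C.T Γ B
  abs : ∀ (Γ : List Ty) (A B : Ty), C.T (Γ ++ [A]) B → C.T Γ (Ty.arrow A B)

/-- The laws of an algebra for the presentation of the STLC with βη-equality: the clone laws,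
commutation of `app` and `abs` with substitution, and the β- and η-laws. -/
def IsSTLCAlg (M : STLCAlgData) : Prop :=
  IsClone M.C ∧
  (∀ (Γ Ξ : List Ty) (A B : Ty) (t : M.C.T Γ (Ty.arrow A B)) (u : M.C.T Γ A)
      (σ : M.C.Sub Ξ Γ),
    M.C.substC (M.app Γ A B t u) σ = M.app Ξ A B (M.C.substC t σ) (M.C.substC u σ)) ∧
  (∀ (Γ Ξ : List Ty) (A B : Ty) (t : M.C.T (Γ ++ [A]) B) (σ : M.C.Sub Ξ Γ),
    M.C.substC (M.abs Γ A B t) σ = M.abs Ξ A B (M.C.substC t (M.C.liftSub σ [A]))) ∧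
  (∀ (Γ : List Ty) (A B : Ty) (t : M.C.T (Γ ++ [A]) B) (u : M.C.T Γ A),
    M.app Γ A B (M.abs Γ A B t) u = M.C.substC t (M.C.snocSub (M.C.varC Γ) u)) ∧
  (∀ (Γ : List Ty) (A B : Ty) (t : M.C.T Γ (Ty.arrow A B)),
    M.abs Γ A B
        (M.app (Γ ++ [A]) A B (M.C.substC t (M.C.wkVar Γ [A])) (M.C.lastVar Γ A)) = t)

/-- Homomorphisms of STLC algebras: clone homomorphisms preserving `app` and `abs`. -/
def IsSTLCHom (M N : STLCAlgData) (g : ∀ (Γ : List Ty) (A : Ty), M.C.T Γ A → N.C.T Γ A) :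
    Prop :=
  IsCloneHom M.C N.C g ∧
  (∀ (Γ : List Ty) (A B : Ty) (t : M.C.T Γ (Ty.arrow A B)) (u : M.C.T Γ A),
    g Γ B (M.app Γ A B t u) = N.app Γ A B (g Γ (Ty.arrow A B) t) (g Γ A u)) ∧
  (∀ (Γ : List Ty) (A B : Ty) (t : M.C.T (Γ ++ [A]) B),
    g Γ (Ty.arrow A B) (M.abs Γ A B t) = N.abs Γ A B (g (Γ ++ [A]) B t))

/-- `F` together with `η : X → F` is the free STLC βη-algebra on the clone `X`. -/
def IsFreeSTLCAlg (X : CloneData Ty) (F : STLCAlgData)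
    (η : ∀ (Γ : List Ty) (A : Ty), X.T Γ A → F.C.T Γ A) : Prop :=
  IsSTLCAlg F ∧ IsCloneHom X F.C η ∧
  ∀ N : STLCAlgData, IsSTLCAlg N →
    ∀ f : ∀ (Γ : List Ty) (A : Ty), X.T Γ A → N.C.T Γ A, IsCloneHom X N.C f →
      ∃! g : ∀ (Γ : List Ty) (A : Ty), F.C.T Γ A → N.C.T Γ A,
        IsSTLCHom F N g ∧ ∀ Γ A t, g Γ A (η Γ A t) = f Γ A t

/-- Variable renamings `Δ → Γ`: a sort-preserving choice of a variable of `Δ` for each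
variable of `Γ`. -/
def RenS (S : Type) (Δ Γ : List S) : Type :=
  (i : Fin Γ.length) → { j : Fin Δ.length // Δ.get j = Γ.get i }

/-- The substitution `▷ρ ∈ Y(Δ;Γ)` of variables of `Y` corresponding to a renaming `ρ`. -/
def CloneData.renSub {S : Type} (Y : CloneData S) {Δ Γ : List S} (ρ : RenS S Δ Γ) :
    Y.Sub Δ Γ := fun i => Y.castT (ρ i).2 (Y.varC Δ (ρ i).1)

/-- The Kripke logical relation determined by a family of subsets at base type:
`Q(Γ; A⇒B) = { t | ∀ ρ : Var(Δ;Γ), ∀ a ∈ Q(Δ;A), ⟦app⟧(t[▷ρ],a) ∈ Q(Δ;B) }`. -/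
def KLR (Y : STLCAlgData) (Q0 : ∀ Γ : List Ty, Set (Y.C.T Γ Ty.base)) :
    (A : Ty) → (Γ : List Ty) → Set (Y.C.T Γ A)
  | Ty.base, Γ => Q0 Γ
  | Ty.arrow A B, Γ =>
      {t | ∀ (Δ : List Ty) (ρ : RenS Ty Δ Γ) (a : Y.C.T Δ A), a ∈ KLR Y Q0 A Δ →
        Y.app Δ A B (Y.C.substC t (Y.C.renSub ρ)) a ∈ KLR Y Q0 B Δ}

namespace CloneData

variable {S : Type}

@[simp] theorem castT_rfl (X : CloneData S) {Γ : List S} {A : S} (h : A = A) (t : X.T Γ A) :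
    X.castT h t = t := rfl

@[simp] theorem castT_castT (X : CloneData S) {Γ : List S} {A B C : S} (h : A = B) (h' : B = C)
    (t : X.T Γ A) : X.castT h' (X.castT h t) = X.castT (h.trans h') t := by
  subst h h'; rfl

theorem substC_castT (X : CloneData S) {Γ Δ : List S} {A B : S} (h : A = B) (t : X.T Δ A)
    (σ : X.Sub Γ Δ) : X.substC (X.castT h t) σ = X.castT h (X.substC t σ) := by
  subst h; rfl

theorem map_castT {X Y : CloneData S} (f : ∀ (Γ : List S) (A : S), X.T Γ A → Y.T Γ A)
    {Γ : List S} {A B : S} (h : A = B) (t : X.T Γ A) :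
    f Γ B (X.castT h t) = Y.castT h (f Γ A t) := by
  subst h; rfl

theorem map_snocSub {X Y : CloneData S} (f : ∀ (Γ : List S) (A : S), X.T Γ A → Y.T Γ A)
    {Ξ Γ : List S} {A : S} (σ : X.Sub Ξ Γ) (u : X.T Ξ A) (j : Fin (Γ ++ [A]).length) :
    f _ _ (X.snocSub σ u j) = Y.snocSub (fun i => f _ _ (σ i)) (f _ _ u) j := by
  by_cases h : (j : ℕ) < Γ.length
  · simp only [snocSub, dif_pos h, map_castT]
  · simp only [snocSub, dif_neg h, map_castT]

/-- Weakening followed by instantiating the last variable leaves the original substitution. -/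
theorem wkVar_snocSub {X : CloneData S} (hX : IsClone X) {Ξ Γ : List S} {A : S}
    (σ : X.Sub Ξ Γ) (u : X.T Ξ A) :
    (fun i => X.substC (X.wkVar Γ [A] i) (X.snocSub σ u)) = σ := by
  funext i
  simp [wkVar, substC_castT, hX.1, snocSub]

theorem liftSub_snocSub {X : CloneData S} (hX : IsClone X) {Ξ Γ : List S} {A : S}
    (σ : X.Sub Ξ Γ) (u : X.T Ξ A) :
    (fun i => X.substC (X.liftSub σ [A] i) (X.snocSub (X.varC Ξ) u)) = X.snocSub σ u := by
  funext j
  by_cases h : (j : ℕ) < Γ.length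
  · simp only [liftSub, snocSub, dif_pos h, substC_castT]
    congr 1
    rw [← hX.2.2]
    exact (congrArg _ (wkVar_snocSub hX (X.varC Ξ) u)).trans (hX.2.1 _ _ _)
  · simp [liftSub, snocSub, dif_neg h, substC_castT, hX.1]

/-- Composition of renamings. -/
def renComp {Δ Γ Ξ : List S} (ρ : RenS S Δ Γ) (ρ' : RenS S Ξ Δ) : RenS S Ξ Γ := fun i =>
  ⟨(ρ' (ρ i).1).1, (ρ' (ρ i).1).2.trans (ρ i).2⟩

theorem substC_renSub_renSub {X : CloneData S} (hX : IsClone X) {Δ Γ Ξ : List S} {A : S}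
    (t : X.T Γ A) (ρ : RenS S Δ Γ) (ρ' : RenS S Ξ Δ) :
    X.substC (X.substC t (X.renSub ρ)) (X.renSub ρ') = X.substC t (X.renSub (renComp ρ ρ')) := by
  rw [← hX.2.2]
  congr 1
  funext i
  simp [renSub, substC_castT, hX.1, renComp]

end CloneData

namespace IsCloneHom

variable {S : Type} {X Y : CloneData S} {f : ∀ (Γ : List S) (A : S), X.T Γ A → Y.T Γ A}

theorem map_wkVar (hf : IsCloneHom X Y f) (Γ Ξ : List S) (i : Fin Γ.length) :
    f _ _ (X.wkVar Γ Ξ i) = Y.wkVar Γ Ξ i := by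
  simp only [CloneData.wkVar, CloneData.map_castT, hf.1]

theorem map_lastVar (hf : IsCloneHom X Y f) (Γ : List S) (A : S) :
    f _ _ (X.lastVar Γ A) = Y.lastVar Γ A := by
  simp only [CloneData.lastVar, CloneData.map_castT, hf.1]

theorem map_liftSub (hf : IsCloneHom X Y f) {Ξ Γ : List S} (σ : X.Sub Ξ Γ) (Δ : List S)
    (j : Fin (Γ ++ Δ).length) :
    f _ _ (X.liftSub σ Δ j) = Y.liftSub (fun i => f _ _ (σ i)) Δ j := by
  by_cases h : (j : ℕ) < Γ.length
  · simp only [CloneData.liftSub, dif_pos h, CloneData.map_castT, hf.2, hf.map_wkVar]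
  · simp only [CloneData.liftSub, dif_neg h, CloneData.map_castT, hf.1]

/-- The clone laws are reflected by injective homomorphisms. -/
theorem isClone_of_injective (hf : IsCloneHom X Y f)
    (hinj : ∀ Γ A, Function.Injective (f Γ A)) (hY : IsClone Y) : IsClone X := by
  refine ⟨fun Γ Δ i σ => hinj _ _ ?_, fun Γ A t => hinj _ _ ?_,
    fun Γ Δ Ξ A t σ' σ => hinj _ _ ?_⟩
  · rw [hf.2, hf.1, hY.1]
  · simp only [hf.2, hf.1, hY.2.1]
  · simp only [hf.2, hY.2.2]

theorem comp {Z : CloneData S} {g : ∀ (Γ : List S) (A : S), Y.T Γ A → Z.T Γ A}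
    (hg : IsCloneHom Y Z g) (hf : IsCloneHom X Y f) :
    IsCloneHom X Z (fun Γ A t => g Γ A (f Γ A t)) :=
  ⟨fun Γ i => by simp only [hf.1, hg.1], fun Γ Δ A t σ => by simp only [hf.2, hg.2]⟩

end IsCloneHom

namespace IsSTLCHom

variable {M N K : STLCAlgData} {g : ∀ (Γ : List Ty) (A : Ty), M.C.T Γ A → N.C.T Γ A}

/-- The laws of an STLC algebra are reflected by injective homomorphisms. -/
theorem isSTLCAlg_of_injective (hg : IsSTLCHom M N g)
    (hinj : ∀ Γ A, Function.Injective (g Γ A)) (hN : IsSTLCAlg N) : IsSTLCAlg M := by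
  obtain ⟨hc, happ, habs⟩ := hg
  obtain ⟨hclone, hsapp, hsabs, hbeta, heta⟩ := hN
  refine ⟨hc.isClone_of_injective hinj hclone, fun Γ Ξ A B t u σ => hinj _ _ ?_,
    fun Γ Ξ A B t σ => hinj _ _ ?_, fun Γ A B t u => hinj _ _ ?_, fun Γ A B t => hinj _ _ ?_⟩
  · simp only [hc.2, happ, hsapp]
  · simp only [hc.2, habs, hsabs, hc.map_liftSub]
  · simp only [hc.2, happ, habs, hbeta, CloneData.map_snocSub, hc.1]
  · simp only [hc.2, happ, habs, hc.map_wkVar, hc.map_lastVar, heta]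

theorem comp {k : ∀ (Γ : List Ty) (A : Ty), N.C.T Γ A → K.C.T Γ A}
    (hk : IsSTLCHom N K k) (hg : IsSTLCHom M N g) :
    IsSTLCHom M K (fun Γ A t => k Γ A (g Γ A t)) :=
  ⟨hk.1.comp hg.1, fun Γ A B t u => by simp only [hg.2.1, hk.2.1],
    fun Γ A B t => by simp only [hg.2.2, hk.2.2]⟩

end IsSTLCHom

/-- A family of subsets of an STLC algebra closed under all the operations. -/
structure IsSTLCSubalg (Y : STLCAlgData) (P : ∀ (Γ : List Ty) (A : Ty), Set (Y.C.T Γ A)) :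
    Prop where
  var_mem : ∀ Γ i, Y.C.varC Γ i ∈ P Γ (Γ.get i)
  subst_mem : ∀ {Γ Δ A} {t : Y.C.T Δ A} {σ : Y.C.Sub Γ Δ}, t ∈ P Δ A →
    (∀ i, σ i ∈ P Γ (Δ.get i)) → Y.C.substC t σ ∈ P Γ A
  app_mem : ∀ {Γ A B} {t : Y.C.T Γ (Ty.arrow A B)} {u : Y.C.T Γ A}, t ∈ P Γ (Ty.arrow A B) →
    u ∈ P Γ A → Y.app Γ A B t u ∈ P Γ B
  abs_mem : ∀ {Γ A B} {t : Y.C.T (Γ ++ [A]) B}, t ∈ P (Γ ++ [A]) B →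
    Y.abs Γ A B t ∈ P Γ (Ty.arrow A B)

namespace IsSTLCSubalg

variable {Y : STLCAlgData} {P : ∀ (Γ : List Ty) (A : Ty), Set (Y.C.T Γ A)}

/-- The algebra carried by a closed family of subsets. -/
def toAlg (hP : IsSTLCSubalg Y P) : STLCAlgData where
  C :=
    { T := fun Γ A => P Γ A
      varC := fun Γ i => ⟨Y.C.varC Γ i, hP.var_mem Γ i⟩
      substC := fun t σ =>
        ⟨Y.C.substC t.1 (fun i => (σ i).1), hP.subst_mem t.2 (fun i => (σ i).2)⟩ }
  app := fun Γ A B t u => ⟨Y.app Γ A B t.1 u.1, hP.app_mem t.2 u.2⟩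
  abs := fun Γ A B t => ⟨Y.abs Γ A B t.1, hP.abs_mem t.2⟩

theorem isSTLCHom_val (hP : IsSTLCSubalg Y P) :
    IsSTLCHom hP.toAlg Y (fun _ _ t => t.1) :=
  ⟨⟨fun _ _ => rfl, fun _ _ _ _ _ => rfl⟩, fun _ _ _ _ _ => rfl, fun _ _ _ _ => rfl⟩

theorem isSTLCAlg_toAlg (hP : IsSTLCSubalg Y P) (hY : IsSTLCAlg Y) : IsSTLCAlg hP.toAlg :=
  hP.isSTLCHom_val.isSTLCAlg_of_injective (fun _ _ => Subtype.val_injective) hY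

end IsSTLCSubalg

/-- Induction principle for free algebras: the extension of `f` to the free algebra takes values
in every subalgebra containing the values of `f`. -/
theorem IsFreeSTLCAlg.mem_of_isSTLCSubalg {X : CloneData Ty} {F : STLCAlgData}
    {η : ∀ (Γ : List Ty) (A : Ty), X.T Γ A → F.C.T Γ A} (hF : IsFreeSTLCAlg X F η)
    {Y : STLCAlgData} (hY : IsSTLCAlg Y)
    {f : ∀ (Γ : List Ty) (A : Ty), X.T Γ A → Y.C.T Γ A} (hf : IsCloneHom X Y.C f)
    {g : ∀ (Γ : List Ty) (A : Ty), F.C.T Γ A → Y.C.T Γ A} (hg : IsSTLCHom F Y g)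
    (hgη : ∀ Γ A t, g Γ A (η Γ A t) = f Γ A t)
    {P : ∀ (Γ : List Ty) (A : Ty), Set (Y.C.T Γ A)} (hP : IsSTLCSubalg Y P)
    (hfP : ∀ Γ A t, f Γ A t ∈ P Γ A) (Γ : List Ty) (A : Ty) (t : F.C.T Γ A) :
    g Γ A t ∈ P Γ A := by
  obtain ⟨k, ⟨hk, hkη⟩, -⟩ := hF.2.2 hP.toAlg (hP.isSTLCAlg_toAlg hY)
    (fun Γ A t => ⟨f Γ A t, hfP Γ A t⟩)
    ⟨fun Γ i => Subtype.ext (hf.1 Γ i), fun Γ Δ A t σ => Subtype.ext (hf.2 Γ Δ A t σ)⟩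
  have hgk : g = fun Γ A t => (k Γ A t).1 :=
    (hF.2.2 Y hY f hf).unique ⟨hg, hgη⟩
      ⟨hP.isSTLCHom_val.comp hk, fun Γ A t => congrArg Subtype.val (hkη Γ A t)⟩
  rw [hgk]
  exact (k Γ A t).2

section KLR

variable {Y : STLCAlgData} {Q0 : ∀ Γ : List Ty, Set (Y.C.T Γ Ty.base)}

theorem castT_mem_KLR {Γ : List Ty} {A B : Ty} (h : A = B) {t : Y.C.T Γ A}
    (ht : t ∈ KLR Y Q0 A Γ) : Y.C.castT h t ∈ KLR Y Q0 B Γ := by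
  subst h; exact ht

theorem snocSub_mem_KLR {Ξ Γ : List Ty} {A : Ty} {σ : Y.C.Sub Ξ Γ} {u : Y.C.T Ξ A}
    (hσ : ∀ i, σ i ∈ KLR Y Q0 (Γ.get i) Ξ) (hu : u ∈ KLR Y Q0 A Ξ)
    (j : Fin (Γ ++ [A]).length) :
    Y.C.snocSub σ u j ∈ KLR Y Q0 ((Γ ++ [A]).get j) Ξ := by
  unfold CloneData.snocSub
  split
  · exact castT_mem_KLR _ (hσ _)
  · exact castT_mem_KLR _ hu

theorem substC_renSub_mem_KLR (hY : IsClone Y.C)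
    (hren : ∀ (Γ Δ : List Ty) (ρ : RenS Ty Δ Γ) (t : Y.C.T Γ Ty.base),
      t ∈ Q0 Γ → Y.C.substC t (Y.C.renSub ρ) ∈ Q0 Δ)
    {A : Ty} {Γ Δ : List Ty} (ρ : RenS Ty Δ Γ) {t : Y.C.T Γ A} (ht : t ∈ KLR Y Q0 A Γ) :
    Y.C.substC t (Y.C.renSub ρ) ∈ KLR Y Q0 A Δ := by
  cases A with
  | base => exact hren Γ Δ ρ t ht
  | arrow A B =>
    intro Ξ ρ' a ha
    rw [CloneData.substC_renSub_renSub hY]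
    exact ht Ξ _ a ha

theorem app_mem_KLR (hY : IsClone Y.C) {Γ : List Ty} {A B : Ty} {t : Y.C.T Γ (Ty.arrow A B)}
    {u : Y.C.T Γ A} (ht : t ∈ KLR Y Q0 (Ty.arrow A B) Γ) (hu : u ∈ KLR Y Q0 A Γ) :
    Y.app Γ A B t u ∈ KLR Y Q0 B Γ := by
  have h : Y.app Γ A B (Y.C.substC t (Y.C.varC Γ)) u ∈ KLR Y Q0 B Γ :=
    ht Γ (fun i => ⟨i, rfl⟩) u hu
  rwa [hY.2.1] at h

variable (Y Q0) in
/-- The terms all of whose substitution instances along `KLR`-substitutions lie in `KLR`. -/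
def substKLR (Γ : List Ty) (A : Ty) : Set (Y.C.T Γ A) :=
  {t | ∀ (Δ : List Ty) (σ : Y.C.Sub Δ Γ), (∀ j, σ j ∈ KLR Y Q0 (Γ.get j) Δ) →
    Y.C.substC t σ ∈ KLR Y Q0 A Δ}

theorem isSTLCSubalg_substKLR (hY : IsSTLCAlg Y)
    (hren : ∀ (Γ Δ : List Ty) (ρ : RenS Ty Δ Γ) (t : Y.C.T Γ Ty.base),
      t ∈ Q0 Γ → Y.C.substC t (Y.C.renSub ρ) ∈ Q0 Δ) :
    IsSTLCSubalg Y (substKLR Y Q0) := by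
  obtain ⟨hc, hsapp, hsabs, hbeta, -⟩ := hY
  refine ⟨fun Γ i Δ σ hσ => ?_, fun ht hτ Δ σ hσ => ?_, fun ht hu Δ σ hσ => ?_,
    fun {Γ A B t} ht Δ σ hσ Ξ ρ a ha => ?_⟩
  · rw [hc.1]
    exact hσ i
  · rw [← hc.2.2]
    exact ht Δ _ fun i => hτ i Δ σ hσ
  · rw [hsapp]
    exact app_mem_KLR hc (ht Δ σ hσ) (hu Δ σ hσ)
  · rw [← hc.2.2, hsabs, hbeta, ← hc.2.2, CloneData.liftSub_snocSub hc]
    exact ht Ξ _ (snocSub_mem_KLR (fun i => substC_renSub_mem_KLR hc hren ρ (hσ i)) ha)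

end KLR

/-- Fundamental lemma for Kripke logical relations over open STLC terms: if the variables lie
in `Q`, `Q` at base type is closed under renamings, and `f : X → Y` is compatible with `Q`,
then the extension `f̂` of `f` to the free algebra on `X` maps every term into the Kripke
logical relation `Q`. -/
theorem kripke_logical_relations_open (Y : STLCAlgData) (hY : IsSTLCAlg Y)
    (X : CloneData Ty) (hX : IsClone X)
    (f : ∀ (Γ : List Ty) (A : Ty), X.T Γ A → Y.C.T Γ A) (hf : IsCloneHom X Y.C f)
    (Q0 : ∀ Γ : List Ty, Set (Y.C.T Γ Ty.base))
    (F : STLCAlgData) (η : ∀ (Γ : List Ty) (A : Ty), X.T Γ A → F.C.T Γ A)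
    (hF : IsFreeSTLCAlg X F η)
    (g : ∀ (Γ : List Ty) (A : Ty), F.C.T Γ A → Y.C.T Γ A)
    (hg : IsSTLCHom F Y g) (hgη : ∀ Γ A t, g Γ A (η Γ A t) = f Γ A t)
    (hvar : ∀ (Γ : List Ty) (i : Fin Γ.length), Y.C.varC Γ i ∈ KLR Y Q0 (Γ.get i) Γ)
    (hren : ∀ (Γ Δ : List Ty) (ρ : RenS Ty Δ Γ) (t : Y.C.T Γ Ty.base),
      t ∈ Q0 Γ → Y.C.substC t (Y.C.renSub ρ) ∈ Q0 Δ)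
    (hfQ : ∀ (Γ : List Ty) (B : Ty) (t : X.T Γ B) (Δ : List Ty) (σ : Y.C.Sub Δ Γ),
      (∀ j, σ j ∈ KLR Y Q0 (Γ.get j) Δ) → Y.C.substC (f Γ B t) σ ∈ KLR Y Q0 B Δ) :
    ∀ (Γ : List Ty) (A : Ty) (t : F.C.T Γ A), g Γ A t ∈ KLR Y Q0 A Γ := by
  intro Γ A t
  have h := hF.mem_of_isSTLCSubalg hY hf hg hgη (isSTLCSubalg_substKLR hY hren) hfQ Γ A t
    Γ (Y.C.varC Γ) (hvar Γ)
  rwa [hY.1.2.1] at h
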